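/- Let R, C, μ > 0, let n ≥ 1 be an integer with Rμ/C ≥ n + 1, let 0 ≤ a < m < b with m ≤ 1, and let 0 < d < 2(m−a)(b−m)/(b−a). Suppose f_n(b) + f_n'(b)(m−b) < f_n(m), suppose there exists a tangent point ρ_t ∈ (m, b) satisfying f_n(ρ_t) + f_n'(ρ_t)(m − ρ_t) = f_n(m), and suppose d < d₀ := 2(m−a)(ρ_t−m)/(ρ_t−a). Then inf_{P ∈ 𝒫(a,b,m,d)} ∫ f_n(ρ) dP(ρ) = (d/(2(m−a)))·f_n(a) + (1 − d/(2(m−a)) − d/(2(ρ_t−m)))·f_n(m) + (d/(2(ρ_t−m)))·f_n(ρ_t), and the infimum is attained by the three-point probability measure placing masses d/(2(m−a)), 1 − d/(2(m−a)) − d/(2(ρ_t−m)), and d/(2(ρ_t−m)) at a, m, and ρ_t respectively. -/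

import Mathlib

open MeasureTheory

/-- The social benefit rate function `f_n` of Naor's observable M/M/1 queue. -/
noncomputable def socialRate (R C μ : ℝ) (n : ℕ) (ρ : ℝ) : ℝ :=
  if ρ = 1 then R * μ * ((n : ℝ) / ((n : ℝ) + 1)) - C * ((n : ℝ) / 2)
  else R * μ * (ρ * (1 - ρ ^ n) / (1 - ρ ^ (n + 1)))
      - C * (ρ / (1 - ρ) - ((n : ℝ) + 1) * ρ ^ (n + 1) / (1 - ρ ^ (n + 1)))

/-- The MAD ambiguity set: Borel probability measures supported on `[a,b]`
with mean `m` and mean-absolute deviation `d`. -/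
def MADSet (a b m d : ℝ) : Set (Measure ℝ) :=
  {P | IsProbabilityMeasure P ∧ P (Set.Icc a b)ᶜ = 0 ∧
    (∫ ρ, ρ ∂P) = m ∧ (∫ ρ, |ρ - m| ∂P) = d}

open Polynomial in
/-- A real polynomial with a sign variation has a decreasing list of exponents, one more
than its number of sign variations, whose coefficients alternate in sign. -/
theorem exists_alternating_exponents {P : ℝ[X]} (hP : 1 ≤ P.signVariations) :
    ∃ l : List ℕ, l.length = P.signVariations + 1 ∧ l.Pairwise (fun i j => j < i) ∧
      l.IsChain (fun i j => SignType.sign (P.coeff i) ≠ SignType.sign (P.coeff j)) ∧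
      ∀ i ∈ l, P.coeff i ≠ 0 := by
  have hsub := (List.destutter_sublist (· ≠ ·)
    (((coeffList P).map SignType.sign).filter (· ≠ 0))).trans List.filter_sublist
  have hchain := List.isChain_destutter (· ≠ ·)
    (((coeffList P).map SignType.sign).filter (· ≠ 0))
  have hmem : ∀ x ∈ (((coeffList P).map SignType.sign).filter (· ≠ 0)).destutter (· ≠ ·),
      x ≠ 0 := fun x hx => by
    have := (List.destutter_sublist (· ≠ ·) _).subset hx
    simpa using (List.mem_filter.1 this).2
  have hlen : ((((coeffList P).map SignType.sign).filter (· ≠ 0)).destutter (· ≠ ·)).length =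
      P.signVariations + 1 := by
    unfold signVariations at hP ⊢
    omega
  simp only [coeffList, List.map_map] at hsub hchain hmem hlen
  obtain ⟨l, hl, hl'⟩ := List.sublist_map_iff.1 hsub
  refine ⟨l, ?_, ?_, ?_, ?_⟩
  · rw [← hlen, hl', List.length_map]
  · exact List.Pairwise.sublist hl (List.pairwise_reverse.2 List.pairwise_lt_range)
  · rw [hl', List.isChain_map] at hchain
    exact hchain
  · intro i hi h0
    refine hmem (SignType.sign (P.coeff i)) ?_ (by simp [h0])
    rw [hl']
    exact List.mem_map.2 ⟨i, hi, rfl⟩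

theorem mul_neg_of_sign_ne {x y : ℝ} (hx : x ≠ 0) (hy : y ≠ 0)
    (h : SignType.sign x ≠ SignType.sign y) : x * y < 0 := by
  rcases lt_or_gt_of_ne hx with hx | hx <;> rcases lt_or_gt_of_ne hy with hy | hy
  · simp [sign_neg hx, sign_neg hy] at h
  · exact mul_neg_of_neg_of_pos hx hy
  · exact mul_neg_of_pos_of_neg hx hy
  · simp [sign_pos hx, sign_pos hy] at h

open Polynomial in
/-- The coefficients of exponents `1, …, n` strictly decrease, and the degree is at most `n + 1`. -/
structure HasDecreasingMiddle (n : ℕ) (P : ℝ[X]) : Prop where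
  coeff_lt : ∀ i j, 1 ≤ i → i < j → j ≤ n → P.coeff j < P.coeff i
  coeff_eq_zero : ∀ i, n + 1 < i → P.coeff i = 0

namespace HasDecreasingMiddle

open Polynomial

variable {n : ℕ} {P : ℝ[X]}

theorem le_of_coeff_ne_zero (h : HasDecreasingMiddle n P) {i : ℕ} (hi : P.coeff i ≠ 0) :
    i ≤ n + 1 := by
  by_contra! hlt
  exact hi (h.coeff_eq_zero i hlt)

theorem signVariations_le (h : HasDecreasingMiddle n P) : P.signVariations ≤ 3 := by
  by_contra! hlt
  obtain ⟨l, hlen, hl, hc, hne⟩ := exists_alternating_exponents (P := P) (by omega)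
  match l, hlen, hl, hc, hne with
  | i₀ :: i₁ :: i₂ :: i₃ :: i₄ :: l, _, hl, hc, hne =>
    simp only [List.pairwise_cons, List.mem_cons, List.isChain_cons_cons, forall_eq_or_imp] at *
    obtain ⟨h₀, h₁, h₂, h₃, h₄, -⟩ := hne
    have := h.le_of_coeff_ne_zero h₀
    have a₁ := mul_neg_of_sign_ne h₁ h₂ hc.2.1
    have a₂ := mul_neg_of_sign_ne h₂ h₃ hc.2.2.1
    have b₁ := h.coeff_lt i₂ i₁ (by omega) (by omega) (by omega)
    have b₂ := h.coeff_lt i₃ i₂ (by omega) (by omega) (by omega)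
    rcases lt_or_gt_of_ne h₂ with h₂ | h₂ <;> nlinarith
  | [], hlen, _, _, _ | [_], hlen, _, _, _ | [_, _], hlen, _, _, _
  | [_, _, _], hlen, _, _, _ | [_, _, _, _], hlen, _, _, _ =>
    simp at hlen <;> omega

theorem coeff_zero_neg (h : HasDecreasingMiddle n P) (hP : 3 ≤ P.signVariations) :
    P.coeff 0 < 0 := by
  obtain ⟨l, hlen, hl, hc, hne⟩ := exists_alternating_exponents (P := P) (by omega)
  match l, hlen, hl, hc, hne with
  | i₀ :: i₁ :: i₂ :: i₃ :: l, _, hl, hc, hne =>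
    simp only [List.pairwise_cons, List.mem_cons, List.isChain_cons_cons, forall_eq_or_imp] at *
    obtain ⟨h₀, h₁, h₂, h₃, -⟩ := hne
    have := h.le_of_coeff_ne_zero h₀
    have a₁ := mul_neg_of_sign_ne h₁ h₂ hc.2.1
    have a₂ := mul_neg_of_sign_ne h₂ h₃ hc.2.2.1
    have b₁ := h.coeff_lt i₂ i₁ (by omega) (by omega) (by omega)
    have hpos : 0 < P.coeff i₂ := by
      by_contra! hle
      nlinarith
    rcases Nat.eq_zero_or_pos i₃ with rfl | h₃'
    · nlinarith
    · have b₂ := h.coeff_lt i₃ i₂ h₃' (by omega) (by omega)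
      nlinarith
  | [], hlen, _, _, _ | [_], hlen, _, _, _ | [_, _], hlen, _, _, _
  | [_, _, _], hlen, _, _, _ =>
    simp at hlen <;> omega

/-- If three positive roots are factored out, the cofactor is positive on `[0, ∞)`. -/
theorem eval_pos_of_eq_mul {R : ℝ[X]} (h : HasDecreasingMiddle n P) (hP : P ≠ 0) {x y z : ℝ}
    (hx : 0 < x) (hy : 0 < y) (hz : 0 < z)
    (hPR : P = (X - C x) * ((X - C y) * ((X - C z) * R))) {t : ℝ} (ht : 0 ≤ t) :
    0 < R.eval t := by
  have ne_zero {S : ℝ[X]} (hS : S ≠ 0) (w : ℝ) : (X - C w) * S ≠ 0 :=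
    mul_ne_zero (X_sub_C_ne_zero w) hS
  have hR : R ≠ 0 := by
    rintro rfl
    simp [hPR] at hP
  have hsv : R.signVariations + 3 ≤ P.signVariations := by
    have h₁ := succ_signVariations_le_X_sub_C_mul hz hR
    have h₂ := succ_signVariations_le_X_sub_C_mul hy (ne_zero hR z)
    have h₃ := succ_signVariations_le_X_sub_C_mul hx (ne_zero (ne_zero hR z) y)
    rw [hPR]
    omega
  have hroot : ∀ w, 0 < w → R.eval w ≠ 0 := by
    intro w hw hw0
    obtain ⟨S, rfl⟩ := dvd_iff_isRoot.2 hw0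
    have := succ_signVariations_le_X_sub_C_mul hw (right_ne_zero_of_mul hR)
    have := h.signVariations_le
    omega
  have h0 : 0 < R.eval 0 := by
    have hneg := h.coeff_zero_neg (by omega)
    rw [coeff_zero_eq_eval_zero, hPR] at hneg
    simp only [eval_mul, eval_sub, eval_X, eval_C] at hneg
    have hxyz : 0 < x * y * z := by positivity
    by_contra! hle
    nlinarith
  by_contra! hle
  obtain ⟨w, hw, hw0⟩ := intermediate_value_Icc' ht R.continuous.continuousOn ⟨hle, h0.le⟩
  rcases hw.1.eq_or_lt with rfl | hw1
  · exact h0.ne' hw0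
  · exact hroot w hw1 hw0

end HasDecreasingMiddle

section SocialRate

open Polynomial

/-- The numerator of `socialRate` over the common denominator `1 + X + ⋯ + X ^ n`. -/
noncomputable def rateNum (A c : ℝ) (n : ℕ) : ℝ[X] :=
  ∑ i ∈ Finset.range n, monomial (i + 1) (A - c * (i + 1))

/-- The polynomial `1 + X + ⋯ + X ^ n`. -/
noncomputable def geomPoly (n : ℕ) : ℝ[X] := ∑ i ∈ Finset.range (n + 1), X ^ i

/-- The difference of `socialRate` and the line `α + s X`, multiplied by the denominator. -/
noncomputable def rateSubLine (A c : ℝ) (n : ℕ) (α s : ℝ) : ℝ[X] :=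
  rateNum A c n - (C α + C s * X) * geomPoly n

theorem coeff_rateNum (A c : ℝ) (n i : ℕ) :
    (rateNum A c n).coeff i = if 1 ≤ i ∧ i ≤ n then A - c * i else 0 := by
  simp only [rateNum, finsetSum_coeff, coeff_monomial]
  cases i with
  | zero => simp
  | succ i =>
    simp [Finset.sum_ite_eq']

theorem coeff_geomPoly (n i : ℕ) : (geomPoly n).coeff i = if i ≤ n then 1 else 0 := by
  simp [geomPoly, coeff_X_pow]

theorem coeff_rateSubLine_zero (A c : ℝ) (n : ℕ) (α s : ℝ) :
    (rateSubLine A c n α s).coeff 0 = -α := by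
  simp [rateSubLine, coeff_rateNum, coeff_geomPoly, add_mul, mul_assoc]

theorem coeff_rateSubLine_succ (A c : ℝ) (n : ℕ) (α s : ℝ) (i : ℕ) :
    (rateSubLine A c n α s).coeff (i + 1) =
      (if i + 1 ≤ n then A - c * (i + 1) - α else 0) - if i ≤ n then s else 0 := by
  simp only [rateSubLine, coeff_sub, add_mul, mul_assoc, coeff_add, coeff_C_mul, coeff_X_mul,
    coeff_rateNum, coeff_geomPoly]
  split_ifs <;> first | omega | (push_cast; ring)

theorem hasDecreasingMiddle_rateSubLine {A c : ℝ} (hc : 0 < c) (n : ℕ) (α s : ℝ) :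
    HasDecreasingMiddle n (rateSubLine A c n α s) where
  coeff_lt i j hi hij hj := by
    obtain ⟨i, rfl⟩ := Nat.exists_eq_add_of_le' hi
    obtain ⟨j, rfl⟩ := Nat.exists_eq_add_of_le' (hi.trans hij.le)
    have hij' : (i : ℝ) < j := by exact_mod_cast Nat.lt_of_add_lt_add_right hij
    rw [coeff_rateSubLine_succ, coeff_rateSubLine_succ, if_pos hj, if_pos (by omega),
      if_pos (by omega), if_pos (by omega)]
    nlinarith
  coeff_eq_zero i hi := by
    obtain ⟨i, rfl⟩ := Nat.exists_eq_add_of_le' (show 1 ≤ i by omega)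
    rw [coeff_rateSubLine_succ, if_neg (by omega), if_neg (by omega), sub_zero]

theorem rateSubLine_ne_zero {A c : ℝ} (hcA : c < A) {n : ℕ} (hn : 1 ≤ n) (α s : ℝ) :
    rateSubLine A c n α s ≠ 0 := by
  intro h
  have h₀ := coeff_rateSubLine_zero A c n α s
  have h₁ := coeff_rateSubLine_succ A c n α s 0
  have h₂ := coeff_rateSubLine_succ A c n α s n
  simp [h, hn] at h₀ h₁ h₂
  linarith

theorem eval_geomPoly_pos (n : ℕ) {x : ℝ} (hx : 0 ≤ x) : 0 < (geomPoly n).eval x := by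
  simp only [geomPoly, eval_finsetSum, eval_pow, eval_X]
  exact geom_sum_pos hx (Nat.succ_ne_zero n)

theorem eval_rateNum_mul_sq (A c : ℝ) (n : ℕ) (x : ℝ) :
    (rateNum A c n).eval x * (1 - x) ^ 2 = A * (1 - x) * (x - x ^ (n + 1)) -
      c * (x - (n + 1) * x ^ (n + 1) + n * x ^ (n + 2)) := by
  simp only [rateNum, eval_finsetSum, eval_monomial]
  induction n with
  | zero => simp
  | succ n ih =>
    rw [Finset.sum_range_succ, add_mul, ih]
    push_cast
    ring

theorem eval_geomPoly_mul (n : ℕ) (x : ℝ) :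
    (geomPoly n).eval x * (1 - x) = 1 - x ^ (n + 1) := by
  simp only [geomPoly, eval_finsetSum, eval_pow, eval_X]
  exact geom_sum_mul_neg x (n + 1)

theorem eval_rateNum_one (A c : ℝ) (n : ℕ) :
    (rateNum A c n).eval 1 = A * n - c * (n * (n + 1) / 2) := by
  simp only [rateNum, eval_finsetSum, eval_monomial]
  induction n with
  | zero => simp
  | succ n ih =>
    rw [Finset.sum_range_succ, ih]
    push_cast
    ring

theorem socialRate_eq_div (R c μ : ℝ) (n : ℕ) {x : ℝ} (hx : 0 ≤ x) :
    socialRate R c μ n x = (rateNum (R * μ) c n).eval x / (geomPoly n).eval x := by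
  have hS := eval_geomPoly_pos n hx
  rw [eq_div_iff hS.ne']
  rcases eq_or_ne x 1 with rfl | h1
  · have hS1 : (geomPoly n).eval 1 = n + 1 := by simp [geomPoly, eval_finsetSum]
    have : (n : ℝ) + 1 ≠ 0 := by positivity
    rw [eval_rateNum_one, hS1, socialRate, if_pos rfl]
    field_simp
  · have h1' : 1 - x ≠ 0 := sub_ne_zero.2 h1.symm
    have hN := eval_rateNum_mul_sq (R * μ) c n x
    have hG := eval_geomPoly_mul n x
    have hG0 : 1 - x ^ (n + 1) ≠ 0 := hG ▸ mul_ne_zero hS.ne' h1'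
    refine mul_right_cancel₀ (pow_ne_zero 2 h1') ?_
    rw [hN, socialRate, if_neg h1]
    have hG2 : (geomPoly n).eval x * (1 - x) ^ 2 = (1 - x ^ (n + 1)) * (1 - x) := by
      rw [← hG]; ring
    rw [mul_assoc, hG2]
    field_simp
    ring

theorem eval_rateSubLine (R c μ : ℝ) (n : ℕ) (α s : ℝ) {x : ℝ} (hx : 0 ≤ x) :
    (rateSubLine (R * μ) c n α s).eval x =
      (geomPoly n).eval x * (socialRate R c μ n x - (α + s * x)) := by
  have hS := eval_geomPoly_pos n hx
  rw [socialRate_eq_div R c μ n hx]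
  simp only [rateSubLine, eval_sub, eval_mul, eval_add, eval_C, eval_X]
  field_simp

theorem continuousOn_socialRate (R c μ : ℝ) (n : ℕ) :
    ContinuousOn (socialRate R c μ n) (Set.Ici 0) := by
  refine ContinuousOn.congr (f := fun x => (rateNum (R * μ) c n).eval x / (geomPoly n).eval x)
    ?_ fun x hx => socialRate_eq_div R c μ n hx
  exact (rateNum _ c n).continuous.continuousOn.div (geomPoly n).continuous.continuousOn
    fun x hx => (eval_geomPoly_pos n hx).ne'

theorem differentiableAt_socialRate (R c μ : ℝ) (n : ℕ) {x : ℝ} (hx : 0 < x) :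
    DifferentiableAt ℝ (socialRate R c μ n) x := by
  refine DifferentiableAt.congr_of_eventuallyEq
    (f := fun x => (rateNum (R * μ) c n).eval x / (geomPoly n).eval x) ?_ ?_
  · exact (rateNum _ c n).differentiableAt.div (geomPoly n).differentiableAt
      (eval_geomPoly_pos n hx.le).ne'
  · filter_upwards [lt_mem_nhds hx] with y hy using socialRate_eq_div R c μ n hy.le

variable {R c μ : ℝ} {n : ℕ} {m t : ℝ}

/-- The line through `(m, f m)` that touches the graph of `f` at `t > m` leaves a cofactor that is
positive on `[0, ∞)`. -/
theorem exists_tangent_cofactor (hc : 0 < c) (hcA : c < R * μ) (hn : 1 ≤ n) (hm : 0 < m)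
    (hmt : m < t) (htan : socialRate R c μ n t + deriv (socialRate R c μ n) t * (m - t) =
      socialRate R c μ n m) :
    ∃ T : ℝ[X], ∀ x, 0 ≤ x → 0 < T.eval x ∧
      socialRate R c μ n x - (socialRate R c μ n m + deriv (socialRate R c μ n) t * (x - m)) =
        (x - m) * (x - t) ^ 2 * T.eval x / (geomPoly n).eval x := by
  set f := socialRate R c μ n with hf
  set s := deriv f t with hs
  have ht : 0 < t := hm.trans hmt
  set Q := rateSubLine (R * μ) c n (f m - s * m) s with hQ
  have hQ0 : Q ≠ 0 := rateSubLine_ne_zero hcA hn _ _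
  have hQeval : ∀ x, 0 ≤ x → Q.eval x = (geomPoly n).eval x * (f x - (f m - s * m + s * x)) :=
    fun x hx => eval_rateSubLine R c μ n _ _ hx
  have hroot : Q.IsRoot t := by
    rw [IsRoot.def, hQeval t ht.le]
    linear_combination (geomPoly n).eval t * htan
  have hderiv : Q.derivative.IsRoot t := by
    have h₁ : HasDerivAt (fun x => (geomPoly n).eval x * (f x - (f m - s * m + s * x)))
        ((geomPoly n).derivative.eval t * (f t - (f m - s * m + s * t)) +
          (geomPoly n).eval t * (s - s * 1)) t :=
      ((geomPoly n).hasDerivAt t).mul ((differentiableAt_socialRate R c μ n ht).hasDerivAt.sub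
        (((hasDerivAt_id t).const_mul s).const_add _))
    have h₂ : HasDerivAt (fun x => Q.eval x) _ t := h₁.congr_of_eventuallyEq <| by
      filter_upwards [lt_mem_nhds ht] with y hy using hQeval y hy.le
    rw [IsRoot.def, (Q.hasDerivAt t).unique h₂]
    linear_combination (geomPoly n).derivative.eval t * htan
  obtain ⟨U, hU⟩ : (X - C t) ^ 2 ∣ Q :=
    (le_rootMultiplicity_iff hQ0).1 ((one_lt_rootMultiplicity_iff_isRoot hQ0).2 ⟨hroot, hderiv⟩)
  have hUm : U.IsRoot m := by
    have h := hQeval m hm.le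
    rw [hU] at h
    simp only [eval_mul, eval_pow, eval_sub, eval_X, eval_C] at h
    have : (m - t) ^ 2 ≠ 0 := pow_ne_zero 2 (sub_ne_zero.2 hmt.ne)
    exact (mul_eq_zero.1 (h.trans (by ring))).resolve_left this
  obtain ⟨T, rfl⟩ := dvd_iff_isRoot.2 hUm
  refine ⟨T, fun x hx => ⟨(hasDecreasingMiddle_rateSubLine hc n _ _).eval_pos_of_eq_mul hQ0 hm ht ht
    (hU.trans (by ring)) hx, ?_⟩⟩
  rw [eq_div_iff (eval_geomPoly_pos n hx).ne']
  have h := hQeval x hx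
  rw [hU] at h
  simp only [eval_mul, eval_pow, eval_sub, eval_X, eval_C] at h
  linear_combination -h

theorem tangent_line_le (hc : 0 < c) (hcA : c < R * μ) (hn : 1 ≤ n) (hm : 0 < m)
    (hmt : m < t) (htan : socialRate R c μ n t + deriv (socialRate R c μ n) t * (m - t) =
      socialRate R c μ n m) {x : ℝ} (hx : m ≤ x) :
    socialRate R c μ n m + deriv (socialRate R c μ n) t * (x - m) ≤ socialRate R c μ n x := by
  obtain ⟨T, hT⟩ := exists_tangent_cofactor hc hcA hn hm hmt htan
  obtain ⟨h₁, h₂⟩ := hT x (hm.le.trans hx)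
  have h₃ := eval_geomPoly_pos n (hm.le.trans hx)
  have : 0 ≤ x - m := sub_nonneg.2 hx
  rw [← sub_nonneg, h₂]
  positivity

theorem lt_tangent_line (hc : 0 < c) (hcA : c < R * μ) (hn : 1 ≤ n) (hm : 0 < m)
    (hmt : m < t) (htan : socialRate R c μ n t + deriv (socialRate R c μ n) t * (m - t) =
      socialRate R c μ n m) {x : ℝ} (hx : 0 ≤ x) (hxm : x < m) :
    socialRate R c μ n x < socialRate R c μ n m + deriv (socialRate R c μ n) t * (x - m) := by
  obtain ⟨T, hT⟩ := exists_tangent_cofactor hc hcA hn hm hmt htan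
  obtain ⟨h₁, h₂⟩ := hT x hx
  have h₃ := eval_geomPoly_pos n hx
  rw [← sub_neg, h₂]
  have h₄ : 0 < (x - t) ^ 2 := by
    have : x - t ≠ 0 := by linarith
    positivity
  exact div_neg_of_neg_of_pos
    (mul_neg_of_neg_of_pos (mul_neg_of_neg_of_pos (sub_neg.2 hxm) h₄) h₁) h₃

/-- To the left of `m` the graph of `f` lies above its chords ending at `(m, f m)`, provided that
a line through this point touches the graph further to the right. -/
theorem chord_le (hc : 0 < c) (hcA : c < R * μ) (hn : 1 ≤ n) (hmt : m < t)
    (htan : socialRate R c μ n t + deriv (socialRate R c μ n) t * (m - t) =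
      socialRate R c μ n m) {a x : ℝ} (ha : 0 ≤ a) (hax : a ≤ x) (hxm : x < m) :
    (socialRate R c μ n m - socialRate R c μ n x) / (m - x) ≤
      (socialRate R c μ n m - socialRate R c μ n a) / (m - a) := by
  have hm : 0 < m := by linarith
  have ham : a < m := by linarith
  have hx0 : 0 ≤ x := ha.trans hax
  have ht : 0 < t := hm.trans hmt
  have hS := fun {y : ℝ} (hy : 0 ≤ y) => eval_geomPoly_pos n hy
  by_contra! hlt
  obtain ⟨v, hv₁, hv₂⟩ := exists_between hlt
  rw [div_lt_iff₀ (sub_pos.2 ham)] at hv₁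
  rw [lt_div_iff₀ (sub_pos.2 hxm)] at hv₂
  have hane : a ≠ x := by
    rintro rfl
    linarith
  have hax' : a < x := lt_of_le_of_ne hax hane
  have hline := lt_tangent_line hc hcA hn hm hmt htan ha ham
  set f := socialRate R c μ n with hf
  set s := deriv f t with hs
  have hsv : s < v := by
    by_contra! hle
    nlinarith
  set Q := rateSubLine (R * μ) c n (f m - v * m) v with hQ
  have hQ0 : Q ≠ 0 := rateSubLine_ne_zero hcA hn _ _
  have hQeval : ∀ y, 0 ≤ y → Q.eval y = (geomPoly n).eval y * (f y - (f m - v * m + v * y)) :=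
    fun y hy => eval_rateSubLine R c μ n _ _ hy
  obtain ⟨P, hP⟩ : X - C m ∣ Q := dvd_iff_isRoot.2 <| by
    rw [IsRoot.def, hQeval m hm.le]
    ring
  have hPeval : ∀ y, 0 ≤ y →
      (y - m) * P.eval y = (geomPoly n).eval y * (f y - (f m - v * m + v * y)) := by
    intro y hy
    rw [← hQeval y hy, hP]
    simp
  have hPa : P.eval a < 0 := by
    have h : 0 < (a - m) * P.eval a := by
      rw [hPeval a ha]
      exact mul_pos (hS ha) (by linarith)
    exact neg_of_mul_pos_right h (by linarith)
  have hPx : 0 < P.eval x := by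
    have h : (x - m) * P.eval x < 0 := by
      rw [hPeval x hx0]
      exact mul_neg_of_pos_of_neg (hS hx0) (by linarith)
    exact pos_of_mul_neg_right h (by linarith)
  have hPt : P.eval t < 0 := by
    have h : (t - m) * P.eval t < 0 := by
      rw [hPeval t ht.le]
      refine mul_neg_of_pos_of_neg (hS ht.le) ?_
      nlinarith
    exact neg_of_mul_neg_right h (by linarith)
  obtain ⟨y, hy, hy0⟩ := intermediate_value_Ioo hax P.continuous.continuousOn ⟨hPa, hPx⟩
  obtain ⟨z, hz, hz0⟩ := intermediate_value_Ioo' (hxm.trans hmt).le P.continuous.continuousOn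
    ⟨hPt, hPx⟩
  have hyz : y < z := hy.2.trans hz.1
  obtain ⟨P₁, rfl⟩ := dvd_iff_isRoot.2 hy0
  have hz1 : P₁.IsRoot z := by
    simp only [eval_mul, eval_sub, eval_X, eval_C] at hz0
    exact (mul_eq_zero.1 hz0).resolve_left (sub_ne_zero.2 hyz.ne')
  obtain ⟨T, rfl⟩ := dvd_iff_isRoot.2 hz1
  have hT := (hasDecreasingMiddle_rateSubLine hc n _ _).eval_pos_of_eq_mul hQ0 hm
    (ha.trans_lt hy.1) (hx0.trans_lt hz.1) hP ht.le
  simp only [eval_mul, eval_sub, eval_X, eval_C] at hPt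
  have : 0 < (t - y) * ((t - z) * T.eval t) :=
    mul_pos (by linarith [hz.2]) (mul_pos (by linarith [hz.2]) hT)
  linarith

end SocialRate

theorem integrable_of_continuousOn_Icc {P : Measure ℝ} [IsFiniteMeasure P] {a b : ℝ}
    (hP : P (Set.Icc a b)ᶜ = 0) {f : ℝ → ℝ} (hf : ContinuousOn f (Set.Icc a b)) :
    Integrable f P := by
  have h := hf.integrableOn_compact (μ := P) isCompact_Icc
  rwa [IntegrableOn, Measure.restrict_eq_self_of_ae_mem (s := Set.Icc a b) (mem_ae_iff.2 hP)] at h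

/-- A piecewise linear minorant with a kink at `m` bounds the expectation over the ambiguity set. -/
theorem le_integral_of_mem_MADSet {a b m d : ℝ} {P : Measure ℝ} (hP : P ∈ MADSet a b m d)
    {f : ℝ → ℝ} (hf : ContinuousOn f (Set.Icc a b)) {l s₁ s₂ : ℝ}
    (h₁ : ∀ x ∈ Set.Icc a b, x ≤ m → l + s₁ * (x - m) ≤ f x)
    (h₂ : ∀ x ∈ Set.Icc a b, m ≤ x → l + s₂ * (x - m) ≤ f x) :
    l + (s₂ - s₁) / 2 * d ≤ ∫ x, f x ∂P := by
  obtain ⟨hprob, hsupp, hmean, hmad⟩ := hP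
  have i₁ : Integrable (fun x : ℝ => x) P :=
    integrable_of_continuousOn_Icc hsupp continuousOn_id
  have i₂ : Integrable (fun x : ℝ => |x - m|) P :=
    integrable_of_continuousOn_Icc hsupp (by fun_prop)
  have i₃ := i₁.const_mul ((s₁ + s₂) / 2)
  have i₄ := i₂.const_mul ((s₂ - s₁) / 2)
  have i₅ : Integrable (fun _ : ℝ => l - (s₁ + s₂) / 2 * m) P := integrable_const _
  calc l + (s₂ - s₁) / 2 * d
      = ∫ x, ((l - (s₁ + s₂) / 2 * m) + (s₁ + s₂) / 2 * x) + (s₂ - s₁) / 2 * |x - m| ∂P := by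
        have e := integral_add (i₅.add i₃) i₄
        simp only [Pi.add_apply] at e
        rw [e, integral_add i₅ i₃, integral_const_mul, integral_const_mul, hmean, hmad]
        simp
    _ ≤ ∫ x, f x ∂P := by
        refine integral_mono_ae ((i₅.add i₃).add i₄) (integrable_of_continuousOn_Icc hsupp hf) ?_
        filter_upwards [mem_ae_iff.2 hsupp] with x hx
        rcases le_total x m with hxm | hxm
        · have := h₁ x hx hxm
          rw [abs_of_nonpos (sub_nonpos.2 hxm)]
          linarith
        · have := h₂ x hx hxm
          rw [abs_of_nonneg (sub_nonneg.2 hxm)]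
          linarith

theorem integral_three_dirac {p₁ p₂ p₃ : ℝ} (h₁ : 0 ≤ p₁) (h₂ : 0 ≤ p₂) (h₃ : 0 ≤ p₃)
    (x y z : ℝ) (f : ℝ → ℝ) :
    ∫ t, f t ∂(ENNReal.ofReal p₁ • Measure.dirac x + ENNReal.ofReal p₂ • Measure.dirac y +
      ENNReal.ofReal p₃ • Measure.dirac z) = p₁ * f x + p₂ * f y + p₃ * f z := by
  have hi : ∀ (p w : ℝ), Integrable f (ENNReal.ofReal p • Measure.dirac w) := fun p w =>
    (integrable_dirac (by simp)).smul_measure ENNReal.ofReal_ne_top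
  rw [integral_add_measure ((hi _ _).add_measure (hi _ _)) (hi _ _),
    integral_add_measure (hi _ _) (hi _ _)]
  simp [integral_smul_measure, h₁, h₂, h₃]

/-- Case 2 of Proposition 3: if `f_n(b) + f_n'(b)(m-b) < f_n(m)` and `d < d₀`, the
worst-case expected social benefit rate is attained by a three-point distribution
supported on `{a, m, ρ_t}`, where `ρ_t` is the tangent point. -/
theorem stmt7 (R C μ : ℝ) (hR : 0 < R) (hC : 0 < C) (hμ : 0 < μ)
    (n : ℕ) (hn : 1 ≤ n) (hRC : (n : ℝ) + 1 ≤ R * μ / C)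
    (a b m d : ℝ) (ha : 0 ≤ a) (ham : a < m) (hmb : m < b) (hm1 : m ≤ 1)
    (hd0 : 0 < d) (hd : d < 2 * (m - a) * (b - m) / (b - a))
    (hcase : socialRate R C μ n b + deriv (socialRate R C μ n) b * (m - b) <
      socialRate R C μ n m)
    (ρt : ℝ) (hρt : ρt ∈ Set.Ioo m b)
    (htangent : socialRate R C μ n ρt + deriv (socialRate R C μ n) ρt * (m - ρt) =
      socialRate R C μ n m)
    (hdd0 : d < 2 * (m - a) * (ρt - m) / (ρt - a)) :
    let p₁ : ℝ := d / (2 * (m - a))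
    let p₃ : ℝ := d / (2 * (ρt - m))
    let p₂ : ℝ := 1 - p₁ - p₃
    let Pstar : Measure ℝ :=
      ENNReal.ofReal p₁ • Measure.dirac a + ENNReal.ofReal p₂ • Measure.dirac m +
        ENNReal.ofReal p₃ • Measure.dirac ρt
    sInf ((fun P => ∫ ρ, socialRate R C μ n ρ ∂P) '' MADSet a b m d) =
      p₁ * socialRate R C μ n a + p₂ * socialRate R C μ n m + p₃ * socialRate R C μ n ρt ∧
    Pstar ∈ MADSet a b m d ∧
    (∫ ρ, socialRate R C μ n ρ ∂Pstar) =
      p₁ * socialRate R C μ n a + p₂ * socialRate R C μ n m + p₃ * socialRate R C μ n ρt := by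
  intro p₁ p₃ p₂ Pstar
  obtain ⟨hmt, htb⟩ := hρt
  have hm : 0 < m := ha.trans_lt ham
  have hma : 0 < m - a := sub_pos.2 ham
  have htm : 0 < ρt - m := sub_pos.2 hmt
  have hta : 0 < ρt - a := by linarith
  have hcA : C < R * μ := by
    rw [le_div_iff₀ hC] at hRC
    have : (1 : ℝ) ≤ n := by exact_mod_cast hn
    nlinarith
  have hp₁ : 0 ≤ p₁ := by positivity
  have hp₃ : 0 ≤ p₃ := by positivity
  have e₁ : p₁ * (m - a) = d / 2 := by simp only [p₁]; field_simp
  have e₃ : p₃ * (ρt - m) = d / 2 := by simp only [p₃]; field_simp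
  have hp₂ : 0 ≤ p₂ := by
    rw [lt_div_iff₀ hta] at hdd0
    have : p₁ + p₃ = d * (ρt - a) / (2 * (m - a) * (ρt - m)) := by
      simp only [p₁, p₃]
      field_simp
      ring
    have : p₁ + p₃ ≤ 1 := by
      rw [this, div_le_one (by positivity)]
      exact hdd0.le
    simp only [p₂]
    linarith
  have hsum : p₁ + p₂ + p₃ = 1 := by simp only [p₂]; ring
  have hint := integral_three_dirac hp₁ hp₂ hp₃ a m ρt
  have hmem : Pstar ∈ MADSet a b m d := by
    refine ⟨⟨?_⟩, ?_, ?_, ?_⟩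
    · simp only [Pstar, Measure.add_apply, Measure.smul_apply, measure_univ, smul_eq_mul, mul_one]
      rw [← ENNReal.ofReal_add hp₁ hp₂, ← ENNReal.ofReal_add (by positivity) hp₃, hsum,
        ENNReal.ofReal_one]
    · have h₁ : a ∈ Set.Icc a b := ⟨le_rfl, by linarith⟩
      have h₂ : m ∈ Set.Icc a b := ⟨ham.le, hmb.le⟩
      have h₃ : ρt ∈ Set.Icc a b := ⟨by linarith, htb.le⟩
      simp [Pstar, measurableSet_Icc.compl, -Set.mem_Icc, h₁, h₂, h₃]
    · rw [hint (fun ρ => ρ)]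
      linear_combination e₃ - e₁ + m * hsum
    · rw [hint (fun ρ => |ρ - m|), abs_of_neg (by linarith), abs_of_pos htm]
      simp only [sub_self, abs_zero]
      linear_combination e₁ + e₃
  refine ⟨IsLeast.csInf_eq ⟨⟨Pstar, hmem, hint _⟩, ?_⟩, hmem, hint _⟩
  rintro _ ⟨P, hP, rfl⟩
  refine le_trans (le_of_eq ?_) (le_integral_of_mem_MADSet hP
    ((continuousOn_socialRate R C μ n).mono fun x hx => ha.trans hx.1)
    (l := socialRate R C μ n m)
    (s₁ := (socialRate R C μ n m - socialRate R C μ n a) / (m - a))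
    (s₂ := deriv (socialRate R C μ n) ρt) ?_ ?_)
  · have e : (socialRate R C μ n m - socialRate R C μ n a) / (m - a) * (d / 2) =
        p₁ * (socialRate R C μ n m - socialRate R C μ n a) := by
      rw [← e₁]
      field_simp
    linear_combination e + deriv (socialRate R C μ n) ρt * e₃ +
      socialRate R C μ n m * hsum + p₃ * htangent
  · intro x hx hxm
    rcases hxm.eq_or_lt with rfl | hlt
    · simp
    · have h := chord_le hC hcA hn hmt htangent ha hx.1 hlt
      rw [div_le_iff₀ (sub_pos.2 hlt)] at h
      linarith
  · intro x _ hmx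
    exact tangent_line_le hC hcA hn hm hmt htangent hmx
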